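/- There exists a 3-symmetric set P of 315 points in general position in the plane with cr(P) = 152210640. In particular, the rectilinear crossing number satisfies cr(K_315) ≤ 152210640. -/

import Mathlib

/-- A finite planar point set is in general position if no three of its points are collinear. -/
def GenPos (P : Finset (ℝ × ℝ)) : Prop :=
  ∀ p ∈ P, ∀ q ∈ P, ∀ r ∈ P, p ≠ q → p ≠ r → q ≠ r →
    ¬ Collinear ℝ ({p, q, r} : Set (ℝ × ℝ))

/-- A set of points is in convex position if no point lies in the convex hull of the others. -/
def ConvexPos (S : Set (ℝ × ℝ)) : Prop :=
  ∀ p ∈ S, p ∉ convexHull ℝ (S \ {p})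

/-- `crNum P` is the number of 4-element subsets of `P` in convex position. -/
noncomputable def crNum (P : Finset (ℝ × ℝ)) : ℕ :=
  Set.ncard {Q : Finset (ℝ × ℝ) | Q ⊆ P ∧ Q.card = 4 ∧ ConvexPos (↑Q : Set (ℝ × ℝ))}

/-- The rectilinear crossing number of `K_n`: the minimum of `crNum P` over all sets `P` of `n`
points in general position in the plane. -/
noncomputable def rcn (n : ℕ) : ℕ :=
  sInf {c : ℕ | ∃ P : Finset (ℝ × ℝ), P.card = n ∧ GenPos P ∧ crNum P = c}

/-- Rotation by angle `2π/3` about the point `o`. -/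
noncomputable def rot120 (o p : ℝ × ℝ) : ℝ × ℝ :=
  (o.1 + Real.cos (2 * Real.pi / 3) * (p.1 - o.1) - Real.sin (2 * Real.pi / 3) * (p.2 - o.2),
   o.2 + Real.sin (2 * Real.pi / 3) * (p.1 - o.1) + Real.cos (2 * Real.pi / 3) * (p.2 - o.2))

/-- A planar point set is 3-symmetric if some rotation by `2π/3` about a point not in the set
maps the set onto itself. -/
def ThreeSym (P : Finset (ℝ × ℝ)) : Prop :=
  ∃ o : ℝ × ℝ, o ∉ P ∧ rot120 o '' (P : Set (ℝ × ℝ)) = (P : Set (ℝ × ℝ))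

/-- Twice the signed area of the triangle `p q r`, positive for a left turn. -/
def orient {R : Type*} [CommRing R] (p q r : R × R) : R :=
  (q.1 - p.1) * (r.2 - p.2) - (q.2 - p.2) * (r.1 - p.1)

section Orientation

variable {R : Type*} [CommRing R]

theorem orient_rotate (p q r : R × R) : orient q r p = orient p q r := by
  unfold orient; ring

theorem orient_swap (p q r : R × R) : orient q p r = -orient p q r := by
  unfold orient; ring

theorem orient_swap_right (p q r : R × R) : orient p r q = -orient p q r := by
  unfold orient; ring

@[simp]
theorem orient_self_left (p q : R × R) : orient p p q = 0 := by
  unfold orient; ring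

@[simp]
theorem orient_self_right (p q : R × R) : orient p q q = 0 := by
  unfold orient; ring

@[simp]
theorem orient_self_outer (p q : R × R) : orient p q p = 0 := by
  unfold orient; ring

theorem orient_eq_add_add (a b c x : R × R) :
    orient a b c = orient a b x + orient b c x + orient c a x := by
  unfold orient; ring

end Orientation

theorem orient_eq_zero_of_collinear {p q r : ℝ × ℝ}
    (h : Collinear ℝ ({p, q, r} : Set (ℝ × ℝ))) : orient p q r = 0 := by
  obtain ⟨v, hv⟩ := (collinear_iff_of_mem (p₀ := p) (by simp)).1 h
  obtain ⟨s, hs⟩ := hv q (by simp)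
  obtain ⟨t, ht⟩ := hv r (by simp)
  simp only [orient, hs, ht, vadd_eq_add, Prod.fst_add, Prod.snd_add, Prod.smul_fst,
    Prod.smul_snd, smul_eq_mul]
  ring

/-- All nondegenerate triples of points have nonzero orientation. -/
def Nondegenerate (P : Set (ℝ × ℝ)) : Prop :=
  ∀ p ∈ P, ∀ q ∈ P, ∀ r ∈ P, p ≠ q → p ≠ r → q ≠ r → orient p q r ≠ 0

theorem mem_convexHull_triple_iff {a b c x : ℝ × ℝ} (hab : orient a b x ≠ 0)
    (hbc : orient b c x ≠ 0) (hca : orient c a x ≠ 0) :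
    x ∈ convexHull ℝ ({a, b, c} : Set (ℝ × ℝ)) ↔
      (0 < orient a b x ↔ 0 < orient b c x) ∧ (0 < orient b c x ↔ 0 < orient c a x) := by
  have hsum := orient_eq_add_add a b c x
  constructor
  · intro hx
    rw [convexHull_insert (by simp), convexHull_pair, mem_convexJoin] at hx
    obtain ⟨_, rfl, y, ⟨u, v, hu, hv, huv, rfl⟩, s, t, hs, ht, hst, rfl⟩ := hx
    rename_i a
    set x := s • a + t • (u • b + v • c) with hx
    have h₁ : orient a b x = t * v * orient a b c := by
      obtain rfl : s = 1 - t := by linarith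
      obtain rfl : u = 1 - v := by linarith
      simp [hx, orient]; ring
    have h₂ : orient b c x = s * orient a b c := by
      obtain rfl : s = 1 - t := by linarith
      obtain rfl : u = 1 - v := by linarith
      simp [hx, orient]; ring
    have h₃ : orient c a x = t * u * orient a b c := by
      obtain rfl : s = 1 - t := by linarith
      obtain rfl : u = 1 - v := by linarith
      simp [hx, orient]; ring
    rw [h₁] at hab ⊢
    rw [h₂] at hbc ⊢
    rw [h₃] at hca ⊢
    have p₁ : 0 < t * v := lt_of_le_of_ne (by positivity) (left_ne_zero_of_mul hab).symm
    have p₂ : 0 < s := lt_of_le_of_ne hs (left_ne_zero_of_mul hbc).symm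
    have p₃ : 0 < t * u := lt_of_le_of_ne (by positivity) (left_ne_zero_of_mul hca).symm
    simp [mul_pos_iff_of_pos_left, p₁, p₂, p₃]
  · intro h
    have hd : orient a b c ≠ 0 := by
      rcases lt_or_gt_of_ne hbc with h0 | h0
      · have h₁ := not_lt.1 (mt h.1.1 h0.not_gt)
        have h₂ := not_lt.1 (mt h.2.2 h0.not_gt)
        linarith
      · have h₁ := h.1.2 h0
        have h₂ := h.2.1 h0
        linarith
    have hw : ∀ y, (y = orient a b x ∨ y = orient b c x ∨ y = orient c a x) →
        0 ≤ y / orient a b c := by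
      intro y hy
      rcases lt_or_gt_of_ne hbc with h0 | h0
      · have h₁ := not_lt.1 (mt h.1.1 h0.not_gt)
        have h₂ := not_lt.1 (mt h.2.2 h0.not_gt)
        apply div_nonneg_of_nonpos
        · rcases hy with rfl | rfl | rfl <;> linarith
        · linarith
      · have h₁ := h.1.2 h0
        have h₂ := h.2.1 h0
        apply div_nonneg
        · rcases hy with rfl | rfl | rfl <;> linarith
        · linarith
    have hx : x = (orient b c x / orient a b c) • a + (orient c a x / orient a b c) • b +
        (orient a b x / orient a b c) • c := by
      ext <;> simp only [Prod.fst_add, Prod.snd_add, Prod.smul_fst, Prod.smul_snd, smul_eq_mul] <;>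
        field_simp <;> unfold orient <;> ring
    have hmem := (convex_convexHull ℝ ({a, b, c} : Set (ℝ × ℝ))).sum_mem
      (t := Finset.univ)
      (w := ![orient b c x / orient a b c, orient c a x / orient a b c, orient a b x / orient a b c])
      (z := ![a, b, c]) ?_ ?_ ?_
    · simpa [Fin.sum_univ_three, ← hx] using hmem
    · simp [Fin.forall_fin_succ, hw]
    · simp only [Fin.sum_univ_three, Matrix.cons_val]
      field_simp
      linarith
    · intro i _
      apply subset_convexHull
      fin_cases i <;> simp

/-- The orientation predicate on `Fin 4` whose values on the increasing triples
`012`, `013`, `023`, `123` are the given four booleans. -/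
def leftTurn (s t u v : Bool) (i j k : Fin 4) : Bool :=
  match i, j, k with
  | 0, 1, 2 | 1, 2, 0 | 2, 0, 1 => s
  | 0, 2, 1 | 2, 1, 0 | 1, 0, 2 => !s
  | 0, 1, 3 | 1, 3, 0 | 3, 0, 1 => t
  | 0, 3, 1 | 3, 1, 0 | 1, 0, 3 => !t
  | 0, 2, 3 | 2, 3, 0 | 3, 0, 2 => u
  | 0, 3, 2 | 3, 2, 0 | 2, 0, 3 => !u
  | 1, 2, 3 | 2, 3, 1 | 3, 1, 2 => v
  | 1, 3, 2 | 3, 2, 1 | 2, 1, 3 => !v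
  | _, _, _ => false

/-- The point `i` lies inside the triangle `j k l`, in terms of orientations. -/
def inTriangle (s t u v : Bool) (i j k l : Fin 4) : Prop :=
  leftTurn s t u v j k i = leftTurn s t u v k l i ∧
    leftTurn s t u v k l i = leftTurn s t u v l j i

instance (s t u v : Bool) (i j k l : Fin 4) : Decidable (inTriangle s t u v i j k l) :=
  inferInstanceAs (Decidable (_ ∧ _))

/-- Among four points, the number of pairs of distinct points to the left of a common directed
line through two of the points is `8` in convex position and `6` otherwise. -/
theorem card_leftTurn_pairs : ∀ s t u v : Bool,
    ¬ (s = u ∧ t = v ∧ s ≠ t) →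
    (Finset.univ.filter fun x : (Fin 4 × Fin 4) × Fin 4 × Fin 4 =>
      x.2.1 ≠ x.2.2 ∧ leftTurn s t u v x.1.1 x.1.2 x.2.1 ∧
        leftTurn s t u v x.1.1 x.1.2 x.2.2).card =
      if ¬ inTriangle s t u v 0 1 2 3 ∧ ¬ inTriangle s t u v 1 0 2 3 ∧
        ¬ inTriangle s t u v 2 0 1 3 ∧ ¬ inTriangle s t u v 3 0 1 2 then 8 else 6 := by
  decide +kernel

/-- Quadruples `((p, q), r, s)` in `P` such that `r ≠ s` both lie to the left of `p q`. -/
noncomputable def leftPairs (P : Finset (ℝ × ℝ)) :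
    Finset (((ℝ × ℝ) × ℝ × ℝ) × (ℝ × ℝ) × ℝ × ℝ) :=
  ((P ×ˢ P) ×ˢ P ×ˢ P).filter fun x =>
    x.2.1 ≠ x.2.2 ∧ 0 < orient x.1.1 x.1.2 x.2.1 ∧ 0 < orient x.1.1 x.1.2 x.2.2

theorem leftPairs_card (P : Finset (ℝ × ℝ)) :
    (leftPairs P).card = ∑ p ∈ P, ∑ q ∈ P,
      (P.filter fun r => 0 < orient p q r).card *
        ((P.filter fun r => 0 < orient p q r).card - 1) := by
  rw [← Finset.sum_product' P P fun p q => (P.filter fun r => 0 < orient p q r).card *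
        ((P.filter fun r => 0 < orient p q r).card - 1), leftPairs, Finset.card_filter,
    Finset.sum_product]
  refine Finset.sum_congr rfl fun pq _ => ?_
  rw [← Finset.card_filter, Nat.mul_sub_one, ← Finset.offDiag_card]
  congr 1
  ext ⟨r, s⟩
  simp only [Finset.mem_filter, Finset.mem_product, Finset.mem_offDiag]
  tauto

theorem orient_range_pos_iff {e : Fin 4 → ℝ × ℝ} (he : Function.Injective e)
    (hnd : Nondegenerate (Set.range e)) (i j k : Fin 4) :
    0 < orient (e i) (e j) (e k) ↔
      leftTurn (0 < orient (e 0) (e 1) (e 2)) (0 < orient (e 0) (e 1) (e 3))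
        (0 < orient (e 0) (e 2) (e 3)) (0 < orient (e 1) (e 2) (e 3)) i j k := by
  have key : ∀ a b c, a ≠ b → a ≠ c → b ≠ c →
      (0 < orient (e a) (e c) (e b) ↔ ¬ 0 < orient (e a) (e b) (e c)) ∧
      (0 < orient (e b) (e c) (e a) ↔ 0 < orient (e a) (e b) (e c)) ∧
      (0 < orient (e b) (e a) (e c) ↔ ¬ 0 < orient (e a) (e b) (e c)) ∧
      (0 < orient (e c) (e a) (e b) ↔ 0 < orient (e a) (e b) (e c)) ∧
      (0 < orient (e c) (e b) (e a) ↔ ¬ 0 < orient (e a) (e b) (e c)) := by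
    intro a b c hab hac hbc
    have h0 := hnd _ ⟨a, rfl⟩ _ ⟨b, rfl⟩ _ ⟨c, rfl⟩ (he.ne hab) (he.ne hac) (he.ne hbc)
    have hneg : 0 < -orient (e a) (e b) (e c) ↔ ¬ 0 < orient (e a) (e b) (e c) := by
      rw [neg_pos, not_lt, h0.le_iff_lt]
    refine ⟨?_, ?_, ?_, ?_, ?_⟩
    · rw [orient_swap_right, hneg]
    · rw [orient_rotate]
    · rw [orient_swap, hneg]
    · rw [orient_rotate, orient_rotate]
    · rw [orient_swap, orient_rotate, hneg]
  obtain ⟨a1, a2, a3, a4, a5⟩ := key 0 1 2 (by decide) (by decide) (by decide)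
  obtain ⟨b1, b2, b3, b4, b5⟩ := key 0 1 3 (by decide) (by decide) (by decide)
  obtain ⟨c1, c2, c3, c4, c5⟩ := key 0 2 3 (by decide) (by decide) (by decide)
  obtain ⟨d1, d2, d3, d4, d5⟩ := key 1 2 3 (by decide) (by decide) (by decide)
  fin_cases i <;> fin_cases j <;> fin_cases k <;>
    simp only [Fin.zero_eta, Fin.mk_one, Fin.reduceFinMk, Fin.isValue, orient_self_left,
      orient_self_right, orient_self_outer, lt_self_iff_false, leftTurn, *,
      decide_eq_true_eq, Bool.not_eq_true', decide_eq_false_iff_not, Bool.false_eq_true]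

theorem convexPos_range_iff {e : Fin 4 → ℝ × ℝ} (he : Function.Injective e)
    (hnd : Nondegenerate (Set.range e)) {s t u v : Bool}
    (h : ∀ i j k, 0 < orient (e i) (e j) (e k) ↔ leftTurn s t u v i j k) :
    ConvexPos (Set.range e) ↔
      ¬ inTriangle s t u v 0 1 2 3 ∧ ¬ inTriangle s t u v 1 0 2 3 ∧
        ¬ inTriangle s t u v 2 0 1 3 ∧ ¬ inTriangle s t u v 3 0 1 2 := by
  have key : ∀ i j k l : Fin 4, i ≠ j → i ≠ k → i ≠ l → j ≠ k → j ≠ l → k ≠ l →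
      {i}ᶜ = ({j, k, l} : Set (Fin 4)) →
      (e i ∈ convexHull ℝ (Set.range e \ {e i}) ↔ inTriangle s t u v i j k l) := by
    intro i j k l hij hik hil hjk hjl hkl hc
    have h1 : Set.range e \ {e i} = {e j, e k, e l} := by
      rw [← Set.image_univ, ← Set.image_singleton, ← Set.image_sdiff he, ← Set.compl_eq_univ_sdiff,
        hc, Set.image_insert_eq, Set.image_pair]
    have hne : ∀ a b, a ≠ b → a ≠ i → b ≠ i → orient (e a) (e b) (e i) ≠ 0 :=
      fun a b hab ha hb =>
        hnd _ ⟨a, rfl⟩ _ ⟨b, rfl⟩ _ ⟨i, rfl⟩ (he.ne hab) (he.ne ha) (he.ne hb)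
    rw [h1, mem_convexHull_triple_iff (hne _ _ hjk hij.symm hik.symm)
      (hne _ _ hkl hik.symm hil.symm) (hne _ _ hjl.symm hil.symm hij.symm), h, h, h, inTriangle,
      ← Bool.eq_iff_iff, ← Bool.eq_iff_iff]
  rw [ConvexPos, Set.forall_mem_range, Fin.forall_fin_succ, Fin.forall_fin_succ,
    Fin.forall_fin_succ, Fin.forall_fin_succ]
  have hc : ∀ i j k l : Fin 4, (∀ m, m ≠ i ↔ m = j ∨ m = k ∨ m = l) →
      {i}ᶜ = ({j, k, l} : Set (Fin 4)) := by
    intro i j k l h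
    ext m
    simpa using h m
  rw [← key 0 1 2 3 (by decide) (by decide) (by decide) (by decide) (by decide) (by decide)
      (hc _ _ _ _ (by decide)),
    ← key 1 0 2 3 (by decide) (by decide) (by decide) (by decide) (by decide) (by decide)
      (hc _ _ _ _ (by decide)),
    ← key 2 0 1 3 (by decide) (by decide) (by decide) (by decide) (by decide) (by decide)
      (hc _ _ _ _ (by decide)),
    ← key 3 0 1 2 (by decide) (by decide) (by decide) (by decide) (by decide) (by decide)
      (hc _ _ _ _ (by decide))]
  simp [Fin.succ]

open Classical in
theorem leftPairs_card_of_card_eq_four {Q : Finset (ℝ × ℝ)} (hQ : Q.card = 4)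
    (hnd : Nondegenerate (Q : Set (ℝ × ℝ))) :
    (leftPairs Q).card = if ConvexPos (Q : Set (ℝ × ℝ)) then 8 else 6 := by
  let f := (Finset.equivFinOfCardEq hQ).symm
  let e : Fin 4 → ℝ × ℝ := fun i => f i
  have he : Function.Injective e := Subtype.val_injective.comp f.injective
  have hr : Set.range e = Q := by
    ext x
    constructor
    · rintro ⟨i, rfl⟩
      exact (f i).2
    · intro hx
      exact ⟨f.symm ⟨x, hx⟩, by simp [e]⟩
  rw [← hr] at hnd ⊢
  have h := orient_range_pos_iff he hnd
  have hGP : orient (e 0) (e 1) (e 2) + orient (e 0) (e 2) (e 3) =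
      orient (e 0) (e 1) (e 3) + orient (e 1) (e 2) (e 3) := by
    unfold orient; ring
  have hcard := card_leftTurn_pairs (0 < orient (e 0) (e 1) (e 2))
    (0 < orient (e 0) (e 1) (e 3)) (0 < orient (e 0) (e 2) (e 3)) (0 < orient (e 1) (e 2) (e 3)) (by
      rw [decide_eq_decide, decide_eq_decide, ne_eq, decide_eq_decide]
      rintro ⟨h1, h2, h3⟩
      rcases lt_or_ge 0 (orient (e 0) (e 1) (e 2)) with h4 | h4 <;>
        rcases lt_or_ge 0 (orient (e 0) (e 1) (e 3)) with h5 | h5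
      · exact h3 (iff_of_true h4 h5)
      · linarith [h1.1 h4, not_lt.1 (mt h2.2 h5.not_gt)]
      · linarith [not_lt.1 (mt h1.2 h4.not_gt), h2.1 h5]
      · exact h3 (iff_of_false h4.not_gt h5.not_gt))
  simp only [convexPos_range_iff he hnd h]
  rw [← hcard]
  · symm
    apply Finset.card_bij fun x _ => ((e x.1.1, e x.1.2), e x.2.1, e x.2.2)
    · intro x hx
      have hm : ∀ i, e i ∈ Q := fun i => (f i).2
      simp only [Finset.mem_filter, Finset.mem_univ, true_and, ← h] at hx
      simpa [leftPairs, hm, he.eq_iff] using hx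
    · rintro ⟨⟨i, j⟩, k, l⟩ _ ⟨⟨i', j'⟩, k', l'⟩ _ hx
      simpa [he.eq_iff] using hx
    · rintro ⟨⟨p, q⟩, r, s⟩ hx
      have hsurj : ∀ x ∈ Q, ∃ i, e i = x := fun x hx => by
        rwa [← Finset.mem_coe, ← hr] at hx
      simp only [leftPairs, Finset.mem_filter, Finset.mem_product] at hx
      obtain ⟨⟨⟨hp, hq⟩, hr, hs⟩, hx⟩ := hx
      obtain ⟨i, rfl⟩ := hsurj p hp
      obtain ⟨j, rfl⟩ := hsurj q hq
      obtain ⟨k, rfl⟩ := hsurj r hr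
      obtain ⟨l, rfl⟩ := hsurj s hs
      refine ⟨((i, j), k, l), ?_, rfl⟩
      simpa [← h, he.eq_iff] using hx

open Classical in
theorem mem_powersetCard_of_mem_leftPairs {P : Finset (ℝ × ℝ)} {p q r s : ℝ × ℝ}
    (hx : ((p, q), r, s) ∈ leftPairs P) : {p, q, r, s} ∈ P.powersetCard 4 := by
  simp only [leftPairs, Finset.mem_filter, Finset.mem_product] at hx
  obtain ⟨⟨⟨hp, hq⟩, hr, hs⟩, hrs, h1, h2⟩ := hx
  have hpq : p ≠ q := by rintro rfl; simp at h1
  have hpr : p ≠ r := by rintro rfl; simp at h1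
  have hps : p ≠ s := by rintro rfl; simp at h2
  have hqr : q ≠ r := by rintro rfl; simp at h1
  have hqs : q ≠ s := by rintro rfl; simp at h2
  rw [Finset.mem_powersetCard]
  constructor
  · simp [Finset.insert_subset_iff, *]
  · simp [*]

theorem leftPairs_card_eq {P : Finset (ℝ × ℝ)} (hnd : Nondegenerate (P : Set (ℝ × ℝ))) :
    (leftPairs P).card = 6 * P.card.choose 4 + 2 * crNum P := by
  classical
  have hcr : crNum P =
      ((P.powersetCard 4).filter fun Q : Finset (ℝ × ℝ) => ConvexPos (Q : Set (ℝ × ℝ))).card := by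
    rw [crNum, ← Set.ncard_coe_finset]
    congr 1
    ext Q
    simp [Finset.mem_powersetCard, and_assoc]
  let g : ((ℝ × ℝ) × ℝ × ℝ) × (ℝ × ℝ) × ℝ × ℝ → Finset (ℝ × ℝ) :=
    fun x => {x.1.1, x.1.2, x.2.1, x.2.2}
  have hg : Set.MapsTo g (leftPairs P) (P.powersetCard 4) :=
    fun x hx => mem_powersetCard_of_mem_leftPairs hx
  have hfib : ∀ Q ∈ P.powersetCard 4,
      ((leftPairs P).filter fun x => g x = Q).card =
        6 + if ConvexPos (Q : Set (ℝ × ℝ)) then 2 else 0 := by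
    intro Q hQ
    rw [Finset.mem_powersetCard] at hQ
    trans (leftPairs Q).card
    · congr 1
      ext ⟨⟨p, q⟩, r, s⟩
      constructor
      · intro hx
        rw [Finset.mem_filter] at hx
        obtain ⟨hx, rfl⟩ := hx
        simp only [leftPairs, Finset.mem_filter] at hx ⊢
        exact ⟨by simp [g], hx.2⟩
      · intro hx
        have hsub := Finset.mem_powersetCard.1 (mem_powersetCard_of_mem_leftPairs hx)
        rw [Finset.mem_filter]
        refine ⟨?_, Finset.eq_of_subset_of_card_le hsub.1 (by rw [hQ.2, hsub.2])⟩
        simp only [leftPairs, Finset.mem_filter, Finset.mem_product] at hx ⊢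
        exact ⟨⟨⟨hQ.1 hx.1.1.1, hQ.1 hx.1.1.2⟩, hQ.1 hx.1.2.1, hQ.1 hx.1.2.2⟩, hx.2⟩
    · rw [leftPairs_card_of_card_eq_four hQ.2 fun p hp q hq r hr =>
        hnd p (hQ.1 hp) q (hQ.1 hq) r (hQ.1 hr)]
      split_ifs <;> rfl
  rw [Finset.card_eq_sum_card_fiberwise hg, Finset.sum_congr rfl hfib, Finset.sum_add_distrib,
    Finset.sum_const, Finset.card_powersetCard, ← Finset.sum_filter, Finset.sum_const, ← hcr,
    smul_eq_mul, smul_eq_mul]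
  ring

/-- The number whose digits in base `2 ^ 48` are the members of the list, least significant
first. -/
def pack (l : List ℕ) : ℕ :=
  l.foldr (fun d n => d + 2 ^ 48 * n) 0

theorem pack_cons (d : ℕ) (l : List ℕ) : pack (d :: l) = d + 2 ^ 48 * pack l := rfl

theorem pack_map_add {α : Type*} (l : List α) (f g : α → ℕ) :
    pack (l.map fun x => f x + g x) = pack (l.map f) + pack (l.map g) := by
  induction l with
  | nil => rfl
  | cons a l ih => simp only [List.map_cons, pack_cons, ih]; ring

theorem pack_map_mul {α : Type*} (l : List α) (c : ℕ) (f : α → ℕ) :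
    pack (l.map fun x => c * f x) = c * pack (l.map f) := by
  induction l with
  | nil => rfl
  | cons a l ih => simp only [List.map_cons, pack_cons, ih]; ring

theorem add_mul_land_add_mul {d e : ℕ} (hd : d < 2 ^ 48) (he : e < 2 ^ 48) (n m : ℕ) :
    (d + 2 ^ 48 * n) &&& (e + 2 ^ 48 * m) = (d &&& e) + 2 ^ 48 * (n &&& m) := by
  have hmod : ((d + 2 ^ 48 * n) &&& (e + 2 ^ 48 * m)) % 2 ^ 48 = d &&& e := by
    rw [Nat.and_mod_two_pow, Nat.add_mul_mod_self_left, Nat.add_mul_mod_self_left,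
      Nat.mod_eq_of_lt hd, Nat.mod_eq_of_lt he]
  have hdiv : ((d + 2 ^ 48 * n) &&& (e + 2 ^ 48 * m)) / 2 ^ 48 = n &&& m := by
    rw [Nat.and_div_two_pow]
    congr 1 <;> omega
  rw [← hmod, ← hdiv, Nat.mod_add_div]

theorem land_two_pow_of_lt {d : ℕ} (hd : d < 2 ^ 48) :
    d &&& 2 ^ 47 = if 2 ^ 47 ≤ d then 2 ^ 47 else 0 := by
  rw [Nat.and_two_pow, Nat.testBit_eq_decide_div_mod_eq]
  split_ifs with h
  · have : d / 2 ^ 47 % 2 = 1 := by omega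
    rw [this]; rfl
  · have : d / 2 ^ 47 % 2 = 0 := by omega
    rw [this]; rfl

/-- Masking the top bit of every digit counts the digits that are at least `2 ^ 47`. -/
theorem pack_land_mod (l : List ℕ) (hl : ∀ d ∈ l, d < 2 ^ 48) (hlen : l.length < 2 ^ 48 - 1) :
    2 * (pack l &&& 2 ^ 47 * pack (l.map fun _ => 1)) % (2 ^ 48 - 1) =
      l.countP fun d => 2 ^ 47 ≤ d := by
  have key : 2 * (pack l &&& 2 ^ 47 * pack (l.map fun _ => 1)) ≡
      l.countP fun d => 2 ^ 47 ≤ d [MOD 2 ^ 48 - 1] := by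
    clear hlen
    induction l with
    | nil => rfl
    | cons d l ih =>
      have ih := ih fun x hx => hl x (List.mem_cons_of_mem d hx)
      have hd := hl d List.mem_cons_self
      have hmask : 2 ^ 47 * pack ((d :: l).map fun _ => 1) =
          2 ^ 47 + 2 ^ 48 * (2 ^ 47 * pack (l.map fun _ => 1)) := by
        rw [List.map_cons, pack_cons]; ring
      rw [hmask, pack_cons, add_mul_land_add_mul hd (by norm_num), land_two_pow_of_lt hd,
        List.countP_cons]
      generalize pack l &&& 2 ^ 47 * pack (l.map fun _ => 1) = n at ih
      generalize l.countP _ = c at ih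
      unfold Nat.ModEq at *
      simp only [decide_eq_true_eq]
      split_ifs <;> omega
  rw [← Nat.mod_eq_of_lt (lt_of_le_of_lt List.countP_le_length hlen)]
  exact key

/-- With `X`, `Y`, `O` the packed abscissas, ordinates and ones of a list of points, this is the
number of points of the list on one side of the line `p q`; the offset `m` decides whether points
on the line are counted. -/
def packedCount (X Y O m : ℕ) (p q : ℕ × ℕ) : ℕ :=
  2 * ((q.1 * Y + p.2 * X + (p.1 * q.2 + m) * O - (q.2 * X + p.1 * Y + p.2 * q.1 * O)) &&&
    2 ^ 47 * O) % (2 ^ 48 - 1)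

/-- A bound on coordinates that keeps all packed digits below `2 ^ 48`. -/
def InGrid (p : ℕ × ℕ) : Prop :=
  p.1 < 2 ^ 21 ∧ p.2 < 2 ^ 21

theorem packedCount_eq (l : List (ℕ × ℕ)) (hl : ∀ r ∈ l, InGrid r)
    (hlen : l.length < 2 ^ 48 - 1) {m : ℕ} (hm : 2 ^ 47 - 1 ≤ m) (hm' : m ≤ 2 ^ 47)
    {p q : ℕ × ℕ} (hp : InGrid p) (hq : InGrid q) :
    packedCount (pack (l.map Prod.fst)) (pack (l.map Prod.snd)) (pack (l.map fun _ => 1)) m p q =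
      l.countP fun r =>
        2 ^ 47 + (q.2 * r.1 + p.1 * r.2 + p.2 * q.1) ≤
          q.1 * r.2 + p.2 * r.1 + p.1 * q.2 + m := by
  let f : ℕ × ℕ → ℕ := fun r => q.1 * r.2 + p.2 * r.1 + (p.1 * q.2 + m) * 1
  let g : ℕ × ℕ → ℕ := fun r => q.2 * r.1 + p.1 * r.2 + p.2 * q.1 * 1
  have hbound : ∀ r ∈ l, g r ≤ f r ∧ f r - g r < 2 ^ 48 := by
    intro r hr
    have hr := hl r hr
    have hmul : ∀ {x y : ℕ}, x < 2 ^ 21 → y < 2 ^ 21 → x * y < 2 ^ 42 :=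
      fun hx hy => (Nat.mul_lt_mul'' hx hy).trans_eq (by norm_num)
    have h1 := hmul hq.1 hr.2
    have h2 := hmul hp.2 hr.1
    have h3 := hmul hp.1 hq.2
    have h4 := hmul hq.2 hr.1
    have h5 := hmul hp.1 hr.2
    have h6 := hmul hp.2 hq.1
    dsimp only [f, g]
    omega
  have hf : q.1 * pack (l.map Prod.snd) + p.2 * pack (l.map Prod.fst) +
      (p.1 * q.2 + m) * pack (l.map fun _ => 1) = pack (l.map f) := by
    rw [pack_map_add, pack_map_add, pack_map_mul, pack_map_mul, pack_map_mul]
  have hg : q.2 * pack (l.map Prod.fst) + p.1 * pack (l.map Prod.snd) +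
      p.2 * q.1 * pack (l.map fun _ => 1) = pack (l.map g) := by
    rw [pack_map_add, pack_map_add, pack_map_mul, pack_map_mul, pack_map_mul]
  have hsub : pack (l.map f) - pack (l.map g) = pack (l.map fun r => f r - g r) := by
    apply Nat.sub_eq_of_eq_add
    rw [← pack_map_add]
    congr 1
    refine List.map_congr_left fun r hr => ?_
    have := hbound r hr
    omega
  have hcount := pack_land_mod (l.map fun r => f r - g r)
    (List.forall_mem_map.2 fun r hr => (hbound r hr).2) (by simpa using hlen)
  rw [List.map_map, List.countP_map] at hcount
  rw [packedCount, hf, hg, hsub]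
  refine hcount.trans (List.countP_congr fun r hr => ?_)
  have := hbound r hr
  simp only [Function.comp, decide_eq_true_eq, f, g] at this ⊢
  omega

/-- Representatives of the orbits under `turn`, in lattice coordinates. -/
def orbitReps : List (ℤ × ℤ) :=
  [(113209, 94968), (-367439, 406838), (-296637, -550626), (-430952, 469024), (-16268, -111930),
    (-176689, -213477), (-430264, 468351), (-453592, 488129), (541154, 250563),
    (-482275, 512808), (-472510, 503992), (-276671, 343736), (423158, 214714),
    (-176174, -211049), (-452129, 486912), (-176672, -213397), (-474994, 506271),
    (355001, 188418), (-283109, 348208), (-298038, -552739), (215874, 38680), (213444, 36762),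
    (-296742, -550839), (-367752, 407178), (534625, 248198), (-368784, 408196),
    (-424246, 463468), (-269234, 338495), (-479997, 510852), (-18451, -113345), (216639, 39309),
    (-401241, 444771), (-473701, 505089), (-367381, 406762), (-391758, 437061),
    (-16686, -112202), (630976, 282908), (-176186, -211082), (-343593, -620077),
    (-254262, -497818), (-423870, 463156), (-367954, 407415), (-483263, 513676),
    (-448312, 483721), (-473040, 504480), (498031, 243598), (-38681, 177194), (-207584, -421757),
    (-483108, 513541), (-207278, -421259), (-394417, 439225), (-95494, 16744),
    (-339791, -610874), (-177227, -216098), (620523, 276739), (533598, 248055), (-95289, 17328),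
    (631166, 283020), (-368502, 407931), (-370391, 409787), (551168, 254144), (-368725, 408140),
    (213468, 36781), (-248176, 286388), (607638, 269179), (-479904, 510772), (-34808, 176136),
    (-177314, -216354), (-399847, 443637), (-94913, 18397), (211257, 35008), (-470048, 501759),
    (-282980, 348118), (-276223, 343388), (-430814, 468889), (-254323, -497894),
    (-17623, -112808), (-367378, 406758), (-448475, 483857), (-482745, 513222),
    (-271068, 339779), (-183997, 159631), (-482810, 513279), (216387, 39062), (-407209, -774986),
    (-296497, -550343), (-451064, 486010), (-35934, 176771), (-367991, 407451),
    (-252627, -495947), (-338486, -607707), (-38745, 177199), (-470365, 502022),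
    (-165965, -353956), (-343430, -619713), (353295, 187731), (-390483, 436028),
    (-176778, -212585), (-368534, 407961), (550346, 253847), (-39039, 177314), (216347, 39035),
    (-188460, 166641), (-424014, 463273), (-214492, 208091)]

/-- The rotation by `2π/3` in coordinates with respect to a basis of unit vectors at angle
`2π/3`. -/
def turn (p : ℤ × ℤ) : ℤ × ℤ :=
  (-p.2, p.1 - p.2)

/-- The 315 points of the drawing, in lattice coordinates. -/
def points : List (ℤ × ℤ) :=
  orbitReps ++ (orbitReps.map turn ++ (orbitReps.map turn).map turn)

/-- Translation of the lattice points to natural coordinates. -/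
def grid (p : ℤ × ℤ) : ℕ × ℕ :=
  ((p.1 + 2 ^ 20).toNat, (p.2 + 2 ^ 20).toNat)

/-- The translated points. -/
def gridPoints : List (ℕ × ℕ) :=
  points.map grid

/-- The packed abscissas of the translated points. -/
def gridX : ℕ :=
  pack (gridPoints.map Prod.fst)

/-- The packed ordinates of the translated points. -/
def gridY : ℕ :=
  pack (gridPoints.map Prod.snd)

/-- The packed ones, one for each point. -/
def gridO : ℕ :=
  pack (gridPoints.map fun _ => 1)

/-- The number of points strictly to the left of the line `p q`, through packed arithmetic. -/
def packedLeft (p q : ℕ × ℕ) : ℕ :=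
  packedCount gridX gridY gridO (2 ^ 47 - 1) p q

/-- The number of points on the line `p q` or to the left of it, through packed arithmetic. -/
def packedWeakLeft (p q : ℕ × ℕ) : ℕ :=
  packedCount gridX gridY gridO (2 ^ 47) p q

theorem sum_packedLeft :
    ((orbitReps.map grid).map fun p =>
      (gridPoints.map fun q => packedLeft p q * (packedLeft p q - 1)).sum).sum = 906403340 := by
  decide +kernel

theorem packedWeakLeft_eq :
    ∀ p ∈ orbitReps.map grid, ∀ q ∈ gridPoints,
      packedWeakLeft p q = packedLeft p q + 2 ∨ p = q := by
  decide +kernel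

theorem nodup_gridPoints : gridPoints.Nodup := by
  decide +kernel

theorem bounds_of_mem_points :
    ∀ p ∈ points, (-2 ^ 20 ≤ p.1 ∧ p.1 < 2 ^ 20) ∧ -2 ^ 20 ≤ p.2 ∧ p.2 < 2 ^ 20 := by
  decide +kernel

theorem zero_notMem_points : (0, 0) ∉ points := by
  decide +kernel

theorem length_points : points.length = 315 := by
  decide +kernel

theorem nodup_points : points.Nodup :=
  List.Nodup.of_map _ nodup_gridPoints

theorem cast_grid {p : ℤ × ℤ} (hp : p ∈ points) :
    ((grid p).1 : ℤ) = p.1 + 2 ^ 20 ∧ ((grid p).2 : ℤ) = p.2 + 2 ^ 20 := by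
  have := bounds_of_mem_points p hp
  unfold grid
  omega

theorem inGrid_grid {p : ℤ × ℤ} (hp : p ∈ points) : InGrid (grid p) := by
  have := bounds_of_mem_points p hp
  have := cast_grid hp
  unfold InGrid
  omega

theorem grid_injOn {p q : ℤ × ℤ} (hp : p ∈ points) (hq : q ∈ points) (h : grid p = grid q) :
    p = q := by
  have h1 := cast_grid hp
  have h2 := cast_grid hq
  rw [h] at h1
  ext <;> omega

theorem orient_eq_sub_of_mem {p q r : ℤ × ℤ} (hp : p ∈ points) (hq : q ∈ points)
    (hr : r ∈ points) :
    orient p q r =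
      ((grid q).1 * (grid r).2 + (grid p).2 * (grid r).1 + (grid p).1 * (grid q).2 : ℕ) -
      ((grid q).2 * (grid r).1 + (grid p).1 * (grid r).2 + (grid p).2 * (grid q).1 : ℕ) := by
  push_cast
  rw [(cast_grid hp).1, (cast_grid hp).2, (cast_grid hq).1, (cast_grid hq).2, (cast_grid hr).1,
    (cast_grid hr).2, orient]
  ring

theorem packedCount_grid {m : ℕ} (hm : 2 ^ 47 - 1 ≤ m) (hm' : m ≤ 2 ^ 47) {p q : ℤ × ℤ}
    (hp : p ∈ points) (hq : q ∈ points) :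
    packedCount gridX gridY gridO m (grid p) (grid q) =
      points.countP fun r => 2 ^ 47 - m ≤ orient p q r := by
  have hmem : ∀ r ∈ gridPoints, InGrid r := List.forall_mem_map.2 fun r hr => inGrid_grid hr
  have hlen : gridPoints.length < 2 ^ 48 - 1 := by
    rw [gridPoints, List.length_map, length_points]; norm_num
  rw [gridX, gridY, gridO, packedCount_eq gridPoints hmem hlen hm hm' (inGrid_grid hp)
    (inGrid_grid hq), gridPoints, List.countP_map]
  refine List.countP_congr fun r hr => ?_
  rw [orient_eq_sub_of_mem hp hq hr]
  simp only [Function.comp, decide_eq_true_eq]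
  omega

/-- The number of points strictly to the left of the line `p q`. -/
def leftCount (p q : ℤ × ℤ) : ℕ :=
  points.countP fun r => 0 < orient p q r

theorem packedLeft_grid {p q : ℤ × ℤ} (hp : p ∈ points) (hq : q ∈ points) :
    packedLeft (grid p) (grid q) = leftCount p q := by
  rw [packedLeft, packedCount_grid (by norm_num) (by norm_num) hp hq]
  refine List.countP_congr fun r _ => ?_
  simp only [decide_eq_true_eq]
  omega

theorem packedWeakLeft_grid {p q : ℤ × ℤ} (hp : p ∈ points) (hq : q ∈ points) :
    packedWeakLeft (grid p) (grid q) = points.countP fun r => 0 ≤ orient p q r := by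
  rw [packedWeakLeft, packedCount_grid (by norm_num) (by norm_num) hp hq]
  refine List.countP_congr fun r _ => ?_
  simp

theorem turn_turn_turn (p : ℤ × ℤ) : turn (turn (turn p)) = p := by
  ext <;> simp only [turn] <;> ring

theorem orient_turn (p q r : ℤ × ℤ) : orient (turn p) (turn q) (turn r) = orient p q r := by
  simp only [orient, turn]; ring

theorem perm_map_turn : (points.map turn).Perm points := by
  have h : ((orbitReps.map turn).map turn).map turn = orbitReps := by
    simp [List.map_map, Function.comp_def, turn_turn_turn]
  simp only [points, List.map_append, h]
  rw [← List.append_assoc]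
  exact List.perm_append_comm

theorem mem_points_turn {p : ℤ × ℤ} (hp : p ∈ points) : turn p ∈ points :=
  perm_map_turn.subset (List.mem_map_of_mem hp)

theorem orbitReps_subset {p : ℤ × ℤ} (hp : p ∈ orbitReps) : p ∈ points :=
  List.mem_append_left _ hp

theorem leftCount_turn (p q : ℤ × ℤ) : leftCount (turn p) (turn q) = leftCount p q := by
  rw [leftCount, ← perm_map_turn.countP_eq, List.countP_map, leftCount]
  refine List.countP_congr fun r _ => ?_
  simp [orient_turn]

/-- The number of ordered pairs of distinct points that lie to the left of a common line from
`p` to another point. -/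
def pairsFrom (p : ℤ × ℤ) : ℕ :=
  (points.map fun q => leftCount p q * (leftCount p q - 1)).sum

theorem pairsFrom_turn (p : ℤ × ℤ) : pairsFrom (turn p) = pairsFrom p := by
  rw [pairsFrom, ← (perm_map_turn.map _).sum_eq, List.map_map, pairsFrom]
  simp only [Function.comp_def, leftCount_turn]

theorem sum_pairsFrom : (points.map pairsFrom).sum = 2719210020 := by
  have h : (orbitReps.map pairsFrom).sum = 906403340 := by
    refine Eq.trans ?_ sum_packedLeft
    rw [List.map_map]
    refine congrArg List.sum (List.map_congr_left fun p hp => ?_)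
    rw [pairsFrom, Function.comp, gridPoints, List.map_map]
    refine congrArg List.sum (List.map_congr_left fun q hq => ?_)
    rw [Function.comp, packedLeft_grid (orbitReps_subset hp) hq]
  have hturn : ∀ l : List (ℤ × ℤ), (l.map turn).map pairsFrom = l.map pairsFrom := fun l => by
    rw [List.map_map]
    exact List.map_congr_left fun p _ => pairsFrom_turn p
  rw [points, List.map_append, List.map_append, hturn, hturn, hturn, List.sum_append,
    List.sum_append, h]

theorem orient_ne_zero_of_mem_orbitReps {p q r : ℤ × ℤ} (hp : p ∈ orbitReps) (hq : q ∈ points)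
    (hr : r ∈ points) (hpq : p ≠ q) (hpr : p ≠ r) (hqr : q ≠ r) : orient p q r ≠ 0 := by
  intro h0
  have hp' := orbitReps_subset hp
  have hcount := (packedWeakLeft_eq _ (List.mem_map_of_mem hp) _
    (List.mem_map_of_mem hq)).resolve_right fun h => hpq (grid_injOn hp' hq h)
  rw [packedWeakLeft_grid hp' hq, packedLeft_grid hp' hq, leftCount] at hcount
  have hsplit : ∀ l : List (ℤ × ℤ), (l.countP fun r => 0 ≤ orient p q r) =
      (l.countP fun r => 0 < orient p q r) + l.countP fun r => orient p q r = 0 := by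
    intro l
    induction l with
    | nil => rfl
    | cons a l ih =>
      simp only [List.countP_cons, ih, decide_eq_true_eq]
      split_ifs <;> omega
  have h3 : 3 ≤ points.countP fun r => orient p q r = 0 := by
    have hsub : List.Subperm [p, q, r] points :=
      List.subperm_of_subset (by simp [*]) (by simp [*])
    have := hsub.countP_le fun r => orient p q r = 0
    simpa [h0] using this
  have := hsplit points
  omega

theorem orient_ne_zero {p q r : ℤ × ℤ} (hp : p ∈ points) (hq : q ∈ points)
    (hr : r ∈ points) (hpq : p ≠ q) (hpr : p ≠ r) (hqr : q ≠ r) : orient p q r ≠ 0 := by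
  have step : ∀ {p : ℤ × ℤ}, (∀ q ∈ points, ∀ r ∈ points, p ≠ q → p ≠ r → q ≠ r →
      orient p q r ≠ 0) → ∀ q ∈ points, ∀ r ∈ points, turn p ≠ q → turn p ≠ r → q ≠ r →
      orient (turn p) q r ≠ 0 := by
    intro p h q hq r hr hpq hpr hqr
    obtain ⟨q, hq', rfl⟩ := List.mem_map.1 (perm_map_turn.mem_iff.2 hq)
    obtain ⟨r, hr', rfl⟩ := List.mem_map.1 (perm_map_turn.mem_iff.2 hr)
    rw [orient_turn]
    exact h q hq' r hr' (ne_of_apply_ne _ hpq) (ne_of_apply_ne _ hpr) (ne_of_apply_ne _ hqr)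
  have base : ∀ p ∈ orbitReps, ∀ q ∈ points, ∀ r ∈ points, p ≠ q → p ≠ r → q ≠ r →
      orient p q r ≠ 0 :=
    fun p hp q hq r hr => orient_ne_zero_of_mem_orbitReps hp hq hr
  simp only [points, List.mem_append, List.mem_map] at hp
  obtain hp | ⟨p, hp, rfl⟩ | ⟨_, ⟨p, hp, rfl⟩, rfl⟩ := hp
  · exact base p hp q hq r hr hpq hpr hqr
  · exact step (base p hp) q hq r hr hpq hpr hqr
  · exact step (step (base p hp)) q hq r hr hpq hpr hqr

/-- The embedding of the lattice in the plane as a triangular lattice. -/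
noncomputable def toPlane (p : ℤ × ℤ) : ℝ × ℝ :=
  (p.1 - p.2 / 2, √3 / 2 * p.2)

theorem toPlane_injective : Function.Injective toPlane := by
  intro p q h
  simp only [toPlane, Prod.mk.injEq] at h
  obtain ⟨h1, h2⟩ := h
  have h2 : (p.2 : ℝ) = q.2 := mul_left_cancel₀ (by positivity) h2
  have h1 : (p.1 : ℝ) = q.1 := by rw [h2] at h1; linarith
  ext
  · exact_mod_cast h1
  · exact_mod_cast h2

theorem orient_toPlane (p q r : ℤ × ℤ) :
    orient (toPlane p) (toPlane q) (toPlane r) = √3 / 2 * (orient p q r : ℤ) := by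
  simp only [orient, toPlane]
  push_cast
  ring

theorem orient_toPlane_pos_iff (p q r : ℤ × ℤ) :
    0 < orient (toPlane p) (toPlane q) (toPlane r) ↔ 0 < orient p q r := by
  rw [orient_toPlane, mul_pos_iff_of_pos_left (by positivity), Int.cast_pos]

theorem rot120_toPlane (p : ℤ × ℤ) : rot120 (0, 0) (toPlane p) = toPlane (turn p) := by
  have hcos : Real.cos (2 * Real.pi / 3) = -1 / 2 := by
    rw [show 2 * Real.pi / 3 = Real.pi - Real.pi / 3 by ring, Real.cos_pi_sub,
      Real.cos_pi_div_three]
    norm_num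
  have hsin : Real.sin (2 * Real.pi / 3) = √3 / 2 := by
    rw [show 2 * Real.pi / 3 = Real.pi - Real.pi / 3 by ring, Real.sin_pi_sub,
      Real.sin_pi_div_three]
  have h3 : √3 * √3 = (3 : ℝ) := Real.mul_self_sqrt (by norm_num)
  rw [rot120, hcos, hsin]
  ext
  · simp only [toPlane, turn]
    push_cast
    linear_combination (-(p.2 : ℝ) / 4) * h3
  · simp only [toPlane, turn]
    push_cast
    ring

/-- The drawing of `K_315`. -/
noncomputable def drawing : Finset (ℝ × ℝ) :=
  points.toFinset.map ⟨toPlane, toPlane_injective⟩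

theorem mem_drawing {x : ℝ × ℝ} : x ∈ drawing ↔ ∃ p ∈ points, toPlane p = x := by
  simp [drawing]

theorem card_drawing : drawing.card = 315 := by
  rw [drawing, Finset.card_map, List.toFinset_card_of_nodup nodup_points, length_points]

theorem nondegenerate_drawing : Nondegenerate (drawing : Set (ℝ × ℝ)) := by
  intro x hx y hy z hz hxy hxz hyz
  obtain ⟨p, hp, rfl⟩ := mem_drawing.1 hx
  obtain ⟨q, hq, rfl⟩ := mem_drawing.1 hy
  obtain ⟨r, hr, rfl⟩ := mem_drawing.1 hz
  rw [orient_toPlane]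
  refine mul_ne_zero (by positivity) (Int.cast_ne_zero.2 ?_)
  exact orient_ne_zero hp hq hr (ne_of_apply_ne _ hxy) (ne_of_apply_ne _ hxz)
    (ne_of_apply_ne _ hyz)

theorem genPos_drawing : GenPos drawing :=
  fun p hp q hq r hr hpq hpr hqr h =>
    nondegenerate_drawing p hp q hq r hr hpq hpr hqr (orient_eq_zero_of_collinear h)

theorem threeSym_drawing : ThreeSym drawing := by
  refine ⟨(0, 0), ?_, ?_⟩
  · rw [mem_drawing]
    rintro ⟨p, hp, h⟩
    have h0 : toPlane (0, 0) = (0, 0) := by simp [toPlane]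
    rw [← h0] at h
    exact zero_notMem_points (toPlane_injective h ▸ hp)
  · ext x
    simp only [Set.mem_image, Finset.mem_coe, mem_drawing]
    constructor
    · rintro ⟨_, ⟨p, hp, rfl⟩, rfl⟩
      exact ⟨turn p, mem_points_turn hp, (rot120_toPlane p).symm⟩
    · rintro ⟨p, hp, rfl⟩
      refine ⟨_, ⟨_, mem_points_turn (mem_points_turn hp), rfl⟩, ?_⟩
      rw [rot120_toPlane, turn_turn_turn]

theorem card_filter_drawing (p q : ℤ × ℤ) :
    (drawing.filter fun x => 0 < orient (toPlane p) (toPlane q) x).card = leftCount p q := by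
  rw [drawing, Finset.filter_map, Finset.card_map, leftCount, List.countP_eq_length_filter,
    ← List.toFinset_card_of_nodup (nodup_points.filter _), List.toFinset_filter]
  simp only [Function.comp_def, Function.Embedding.coeFn_mk, orient_toPlane_pos_iff,
    decide_eq_true_eq]

theorem card_leftPairs_drawing : (leftPairs drawing).card = 2719210020 := by
  rw [leftPairs_card, ← sum_pairsFrom, ← List.sum_toFinset _ nodup_points]
  conv_lhs => rw [drawing]
  rw [Finset.sum_map]
  refine Finset.sum_congr rfl fun p _ => ?_
  rw [Finset.sum_map, pairsFrom, ← List.sum_toFinset _ nodup_points]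
  refine Finset.sum_congr rfl fun q _ => ?_
  rw [← card_filter_drawing]
  rfl

theorem crNum_drawing : crNum drawing = 152210640 := by
  have h := leftPairs_card_eq nondegenerate_drawing
  have hchoose : Nat.choose 315 4 = 402464790 := by
    norm_num [Nat.choose_eq_descFactorial_div_factorial, Nat.descFactorial, Nat.factorial]
  rw [card_leftPairs_drawing, card_drawing, hchoose] at h
  omega

/-- There is a 3-symmetric set of 315 points in general position with exactly 152210640 convex
quadrilaterals; in particular the rectilinear crossing number of `K_315` is at most 152210640. -/
theorem exists_good_drawing_K315 :
    ∃ P : Finset (ℝ × ℝ), P.card = 315 ∧ GenPos P ∧ ThreeSym P ∧ crNum P = 152210640 ∧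
      rcn 315 ≤ 152210640 :=
  ⟨drawing, card_drawing, genPos_drawing, threeSym_drawing, crNum_drawing,
    Nat.sInf_le ⟨drawing, card_drawing, genPos_drawing, crNum_drawing⟩⟩
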